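/- There exists a finite set of 19448 unit vectors in the Euclidean space ℝ^20 such that the inner product of any two distinct vectors in the set is at most 1/2. (Equivalently, the kissing number in 20 dimensions is at least 19448.) -/

import Mathlib

open scoped RealInnerProductSpace

namespace Kiss

open Finset

/-- Binary linear code encoder: xor of the generators selected by the bits of `x`. -/
def enc : List ℕ → ℕ → ℕ
  | [], _ => 0
  | g :: gs, x => (if x.testBit 0 then g else 0) ^^^ enc gs (x / 2)

/-- Hamming weight of the lowest `k` bits. -/
def wt : ℕ → ℕ → ℕ
  | 0, _ => 0
  | k + 1, n => n % 2 + wt k (n / 2)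

/-- Generators of the shortened Golay code of length 20. -/
def gD : List ℕ := [7973, 8559, 17118, 34236, 68472, 133589, 265359, 525883]

/-- Generators of an 11-dimensional subcode, of distance 5, of the punctured Golay code. -/
def gE : List ℕ := [5574, 8559, 18493, 36703, 68472, 131894, 263788, 525883, 3190, 348, 696]

/-- The set of positions of ones among the lowest 20 bits. -/
def toSet (n : ℕ) : Finset (Fin 20) := univ.filter (fun i => n.testBit i = true)

theorem enc_xor (gs : List ℕ) (x y : ℕ) : enc gs x ^^^ enc gs y = enc gs (x ^^^ y) := by
  induction gs generalizing x y with
  | nil => simp [enc]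
  | cons g gs ih =>
    have h2 : (x ^^^ y) / 2 = x / 2 ^^^ y / 2 := Nat.xor_div_two
    simp only [enc]
    rw [h2, ← ih, Nat.testBit_xor]
    generalize enc gs (x / 2) = a
    generalize enc gs (y / 2) = b
    apply Nat.eq_of_testBit_eq
    intro i
    cases x.testBit 0 <;> cases y.testBit 0 <;> simp [Nat.testBit_xor] <;>
      cases g.testBit i <;> cases a.testBit i <;> cases b.testBit i <;> rfl

theorem wt_xor (k a b : ℕ) : wt k (a ^^^ b) % 2 = (wt k a + wt k b) % 2 := by
  induction k generalizing a b with
  | zero => simp [wt]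
  | succ k ih =>
    have h2 : (a ^^^ b) / 2 = a / 2 ^^^ b / 2 := Nat.xor_div_two
    have h3 : (a ^^^ b) % 2 = (a + b) % 2 := Nat.xor_mod_two_eq
    simp only [wt, h2]
    have := ih (a / 2) (b / 2)
    omega

theorem wt_zero (k : ℕ) : wt k 0 = 0 := by
  induction k with
  | zero => rfl
  | succ k ih => simp [wt, ih]

theorem wt_and_enc (k P : ℕ) (gs : List ℕ) (h : ∀ g ∈ gs, wt k (P &&& g) % 2 = 0) (y : ℕ) :
    wt k (P &&& enc gs y) % 2 = 0 := by
  induction gs generalizing y with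
  | nil => simp [enc, wt_zero]
  | cons g gs ih =>
    have h1 := ih (fun g hg => h g (List.mem_cons_of_mem _ hg)) (y / 2)
    have h2 := h g List.mem_cons_self
    simp only [enc]
    rw [Nat.and_xor_distrib_left, wt_xor]
    split_ifs
    · omega
    · simp only [Nat.and_zero, wt_zero]; omega

theorem sum_testBit (k n : ℕ) :
    ∑ i : Fin k, (if n.testBit i = true then 1 else 0) = wt k n := by
  induction k generalizing n with
  | zero => simp [wt]
  | succ k ih =>
    rw [Fin.sum_univ_succ]
    simp only [Fin.val_succ, Nat.testBit_succ, wt]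
    rw [ih]
    congr 1
    rcases Nat.mod_two_eq_zero_or_one n with h | h <;> simp [Nat.testBit_zero, h]

theorem card_toSet (n : ℕ) : (toSet n).card = wt 20 n := by
  rw [toSet, card_filter, ← sum_testBit]

theorem toSet_xor (a b : ℕ) : toSet (a ^^^ b) = symmDiff (toSet a) (toSet b) := by
  ext i
  simp only [toSet, mem_filter, mem_univ, true_and, mem_symmDiff, Nat.testBit_xor]
  cases a.testBit i <;> cases b.testBit i <;> simp

theorem toSet_and (a b : ℕ) : toSet (a &&& b) = toSet a ∩ toSet b := by
  ext i
  simp [toSet]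

theorem dist_D : ∀ x < 256, x ≠ 0 → 8 ≤ wt 20 (enc gD x) := by decide +kernel

theorem dist_E : ∀ x < 2048, x ≠ 0 → 5 ≤ wt 20 (enc gE x) := by decide +kernel

/-- Indices of the octads. -/
def octIdx : Finset ℕ := (range 256).filter (fun x => wt 20 (enc gD x) = 8)

theorem card_octIdx : octIdx.card = 130 := by decide +kernel

theorem par_DE : ∀ x < 256, ∀ g ∈ gE, wt 20 (enc gD x &&& g) % 2 = 0 := by decide +kernel

/-- The octads. -/
@[irreducible] def octs : Finset (Finset (Fin 20)) := octIdx.image (fun x => toSet (enc gD x))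

/-- The sign patterns of full support. -/
@[irreducible] def signs : Finset (Finset (Fin 20)) := (range 2048).image (fun x => toSet (enc gE x))

theorem symm_D {x y : ℕ} (hx : x < 256) (hy : y < 256) (h : x ≠ y) :
    8 ≤ (symmDiff (toSet (enc gD x)) (toSet (enc gD y))).card := by
  rw [← toSet_xor, card_toSet, enc_xor]
  exact dist_D _ (Nat.xor_lt_two_pow (n := 8) hx hy) (by simpa [Nat.xor_eq_zero_iff] using h)

theorem symm_E {x y : ℕ} (hx : x < 2048) (hy : y < 2048) (h : x ≠ y) :
    5 ≤ (symmDiff (toSet (enc gE x)) (toSet (enc gE y))).card := by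
  rw [← toSet_xor, card_toSet, enc_xor]
  exact dist_E _ (Nat.xor_lt_two_pow (n := 11) hx hy) (by simpa [Nat.xor_eq_zero_iff] using h)

theorem card_octs : octs.card = 130 := by
  rw [octs, card_image_of_injOn, card_octIdx]
  intro x hx y hy hxy
  by_contra h
  simp only [octIdx, coe_filter, mem_range, Set.mem_ofPred_eq] at hx hy
  have := symm_D hx.1 hy.1 h
  simp only at hxy
  simp [hxy] at this

theorem card_signs : signs.card = 2048 := by
  rw [signs, card_image_of_injOn, card_range]
  intro x hx y hy hxy
  by_contra h
  simp only [coe_range, Set.mem_Iio] at hx hy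
  have := symm_E hx hy h
  simp only at hxy
  simp [hxy] at this

theorem oct_card {P : Finset (Fin 20)} (h : P ∈ octs) : P.card = 8 := by
  simp only [octs, octIdx, mem_image, mem_filter] at h
  obtain ⟨x, ⟨_, h⟩, rfl⟩ := h
  rw [card_toSet, h]

theorem card_symmDiff_add (A B : Finset (Fin 20)) :
    (symmDiff A B).card + 2 * (A ∩ B).card = A.card + B.card := by
  have h1 : (symmDiff A B).card = (A \ B).card + (B \ A).card := by
    rw [symmDiff_def, sup_eq_union, card_union_of_disjoint]
    exact disjoint_sdiff_sdiff
  have h2 := card_sdiff_add_card_inter A B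
  have h3 := card_sdiff_add_card_inter B A
  rw [inter_comm] at h3
  omega

theorem oct_inter {P Q : Finset (Fin 20)} (hP : P ∈ octs) (hQ : Q ∈ octs) (h : P ≠ Q) :
    (P ∩ Q).card ≤ 4 := by
  have h1 := oct_card hP
  have h2 := oct_card hQ
  have h3 := card_symmDiff_add P Q
  simp only [octs, octIdx, mem_image, mem_filter, mem_range] at hP hQ
  obtain ⟨x, ⟨hx, _⟩, rfl⟩ := hP
  obtain ⟨y, ⟨hy, _⟩, rfl⟩ := hQ
  have := symm_D hx hy (by rintro rfl; exact h rfl)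
  omega

theorem oct_sign {P A : Finset (Fin 20)} (hP : P ∈ octs) (hA : A ∈ signs) :
    (P ∩ A).card % 2 = 0 := by
  simp only [octs, octIdx, signs, mem_image, mem_filter, mem_range] at hP hA
  obtain ⟨x, ⟨hx, _⟩, rfl⟩ := hP
  obtain ⟨y, hy, rfl⟩ := hA
  rw [← toSet_and, card_toSet]
  exact wt_and_enc _ _ _ (par_DE x hx) _

theorem sign_dist {A B : Finset (Fin 20)} (hA : A ∈ signs) (hB : B ∈ signs) (h : A ≠ B) :
    5 ≤ (symmDiff A B).card := by
  simp only [signs, mem_image, mem_range] at hA hB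
  obtain ⟨x, hx, rfl⟩ := hA
  obtain ⟨y, hy, rfl⟩ := hB
  exact symm_E hx hy (by rintro rfl; exact h rfl)

/-- Index type: support and set of negative coordinates. -/
abbrev Idx := (_ : Finset (Fin 20)) × Finset (Fin 20)

@[irreducible] def pairSets (n : ℕ) : Finset (Finset (Fin n)) := powersetCard 2 univ
@[irreducible] def T1 : Finset Idx := (pairSets 20).sigma (fun P => P.powerset)
@[irreducible] def T2 : Finset Idx := octs.sigma (fun P => P.powerset.filter (fun S => S.card % 2 = 1))
@[irreducible] def T3 : Finset Idx := ({univ} : Finset (Finset (Fin 20))).sigma (fun _ => signs)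

theorem card_T1 : T1.card = 760 := by
  rw [T1, card_sigma, sum_const_nat (m := 4)]
  · rw [pairSets, card_powersetCard, card_univ, Fintype.card_fin]
    norm_num [Nat.choose]
  · intro P hP
    rw [pairSets] at hP
    rw [card_powerset, (mem_powersetCard.1 hP).2]
    norm_num

theorem card_T2 : T2.card = 16640 := by
  rw [T2, card_sigma, sum_congr rfl (g := fun _ => 128)]
  · simp [card_octs]
  · intro P hP
    rw [card_filter, sum_powerset_apply_card (fun k => if k % 2 = 1 then 1 else 0), oct_card hP]
    decide

theorem card_T3 : T3.card = 2048 := by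
  simp [T3, card_sigma, card_signs]

theorem mem_T1 {p : Idx} (h : p ∈ T1) : p.1.card = 2 ∧ p.2 ⊆ p.1 := by
  rw [T1, mem_sigma, pairSets, mem_powersetCard] at h
  exact ⟨h.1.2, mem_powerset.1 h.2⟩

theorem mem_T2 {p : Idx} (h : p ∈ T2) : p.1 ∈ octs ∧ p.2 ⊆ p.1 ∧ p.2.card % 2 = 1 := by
  simpa [T2] using h

theorem mem_T3 {p : Idx} (h : p ∈ T3) : p.1 = univ ∧ p.2 ∈ signs := by
  simpa [T3] using h

@[irreducible] def T : Finset Idx := T1 ∪ T2 ∪ T3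

theorem card_T : T.card = 19448 := by
  rw [T, card_union_of_disjoint, card_union_of_disjoint, card_T1, card_T2, card_T3]
  · rw [disjoint_left]
    intro p h1 h2
    have h3 := (mem_T1 h1).1
    have h4 := oct_card (mem_T2 h2).1
    omega
  · rw [disjoint_left]
    intro p h1 h2
    have h5 := (mem_T3 h2).1
    have h6 : p.1.card = 20 := by rw [h5]; simp
    rcases mem_union.1 h1 with h1 | h1
    · have h3 := (mem_T1 h1).1
      omega
    · have h4 := oct_card (mem_T2 h1).1
      omega

/-- The sign of coordinate `i`. -/
def sg (A : Finset (Fin 20)) (i : Fin 20) : ℝ := if i ∈ A then -1 else 1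

/-- The unit vector with support `p.1` and negative coordinates `p.2`. -/
noncomputable def vec (p : Idx) : EuclideanSpace ℝ (Fin 20) :=
  WithLp.toLp 2 (fun i => if i ∈ p.1 then sg p.2 i / √(p.1.card : ℝ) else 0)

theorem sum_sg (O A B : Finset (Fin 20)) :
    ∑ i ∈ O, sg A i * sg B i = (O.card : ℝ) - 2 * ((O ∩ symmDiff A B).card : ℝ) := by
  have h : ∀ i ∈ O, sg A i * sg B i = 1 - 2 * (if i ∈ symmDiff A B then 1 else 0) := by
    intro i _
    simp only [sg, mem_symmDiff]
    by_cases hA : i ∈ A <;> by_cases hB : i ∈ B <;> simp [hA, hB] <;> norm_num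
  rw [sum_congr rfl h, sum_sub_distrib, ← mul_sum, sum_ite_mem]
  simp

theorem inner_vec (p q : Idx) : ⟪vec p, vec q⟫ =
    (((p.1 ∩ q.1).card : ℝ) - 2 * ((p.1 ∩ q.1 ∩ symmDiff p.2 q.2).card : ℝ)) /
      (√(p.1.card : ℝ) * √(q.1.card : ℝ)) := by
  rw [← sum_sg, PiLp.inner_apply, sum_div]
  rw [← sum_subset (subset_univ (p.1 ∩ q.1))]
  · refine sum_congr rfl fun i hi => ?_
    have h := mem_inter.1 hi
    simp only [vec, h.1, h.2, if_true, RCLike.inner_apply, conj_trivial]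
    rw [div_mul_div_comm]
    ring
  · intro i _ hi
    simp only [mem_inter, not_and] at hi
    by_cases h : i ∈ p.1
    · simp [vec, hi h]
    · simp [vec, h]

theorem inner_le (p q : Idx) (m : ℕ) (hm : 4 * m ^ 2 ≤ p.1.card * q.1.card)
    (hpos : 0 < p.1.card * q.1.card)
    (h : (p.1 ∩ q.1).card ≤ m + 2 * (p.1 ∩ q.1 ∩ symmDiff p.2 q.2).card) :
    ⟪vec p, vec q⟫ ≤ (1 : ℝ) / 2 := by
  rw [inner_vec, ← Real.sqrt_mul (Nat.cast_nonneg _)]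
  have hp : (0 : ℝ) < (p.1.card : ℝ) * q.1.card := by exact_mod_cast hpos
  rw [div_le_iff₀ (Real.sqrt_pos.2 hp)]
  have h1 : ((p.1 ∩ q.1).card : ℝ) ≤ m + 2 * ((p.1 ∩ q.1 ∩ symmDiff p.2 q.2).card : ℝ) := by
    exact_mod_cast h
  have h2 : (2 * m : ℝ) ≤ √((p.1.card : ℝ) * q.1.card) := by
    apply Real.le_sqrt_of_sq_le
    have : (4 * (m : ℝ) ^ 2) ≤ (p.1.card : ℝ) * q.1.card := by exact_mod_cast hm
    linarith [this, mul_pow (2 : ℝ) m 2]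
  linarith

theorem card_pos_of_mem {p : Idx} (h : p ∈ T) : 0 < p.1.card := by
  simp only [T, mem_union] at h
  rcases h with (h | h) | h
  · rw [(mem_T1 h).1]; norm_num
  · rw [oct_card (mem_T2 h).1]; norm_num
  · rw [(mem_T3 h).1]; simp

theorem norm_vec {p : Idx} (h : p ∈ T) : ‖vec p‖ = 1 := by
  have hp : (0 : ℝ) < p.1.card := by exact_mod_cast card_pos_of_mem h
  have : ‖vec p‖ ^ 2 = 1 := by
    rw [← real_inner_self_eq_norm_sq, inner_vec, Real.mul_self_sqrt hp.le]
    simp [hp.ne']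
  nlinarith [norm_nonneg (vec p)]

theorem symm_pos {A B : Finset (Fin 20)} (h : A ≠ B) : 0 < (symmDiff A B).card := by
  rw [card_pos, nonempty_iff_ne_empty]
  intro h'
  exact h (symmDiff_eq_bot.1 h')

theorem i11 {p q : Idx} (hp : p ∈ T1) (hq : q ∈ T1) (h : p ≠ q) :
    ⟪vec p, vec q⟫ ≤ (1 : ℝ) / 2 := by
  obtain ⟨P, S⟩ := p
  obtain ⟨Q, R⟩ := q
  obtain ⟨hP, hS⟩ := mem_T1 hp
  obtain ⟨hQ, hR⟩ := mem_T1 hq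
  simp only at hP hS hQ hR
  refine inner_le _ _ 1 (by norm_num [hP, hQ]) (by norm_num [hP, hQ]) ?_
  dsimp only
  by_cases hPQ : P = Q
  · subst hPQ
    have hSR : S ≠ R := by rintro rfl; exact h rfl
    have h1 := symm_pos hSR
    have h2 : P ∩ symmDiff S R = symmDiff S R :=
      inter_eq_right.2 (symmDiff_le_sup.trans (union_subset hS hR))
    rw [inter_self, h2]
    omega
  · have h1 := symm_pos hPQ
    have h3 := card_symmDiff_add P Q
    omega

theorem i12 {p q : Idx} (hp : p ∈ T1) (hq : q ∈ T2) :
    ⟪vec p, vec q⟫ ≤ (1 : ℝ) / 2 := by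
  have h1 := (mem_T1 hp).1
  have h2 := oct_card (mem_T2 hq).1
  have h3 := card_le_card (inter_subset_left (s₁ := p.1) (s₂ := q.1))
  refine inner_le _ _ 2 (by norm_num [h1, h2]) (by norm_num [h1, h2]) ?_
  omega

theorem i13 {p q : Idx} (hp : p ∈ T1) (hq : q ∈ T3) :
    ⟪vec p, vec q⟫ ≤ (1 : ℝ) / 2 := by
  have h1 := (mem_T1 hp).1
  have h2 : q.1.card = 20 := by rw [(mem_T3 hq).1]; simp
  have h3 := card_le_card (inter_subset_left (s₁ := p.1) (s₂ := q.1))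
  refine inner_le _ _ 2 (by norm_num [h1, h2]) (by norm_num [h1, h2]) ?_
  omega

theorem i22 {p q : Idx} (hp : p ∈ T2) (hq : q ∈ T2) (h : p ≠ q) :
    ⟪vec p, vec q⟫ ≤ (1 : ℝ) / 2 := by
  obtain ⟨P, S⟩ := p
  obtain ⟨Q, R⟩ := q
  obtain ⟨hP, hS, hS1⟩ := mem_T2 hp
  obtain ⟨hQ, hR, hR1⟩ := mem_T2 hq
  simp only at hP hS hQ hR hS1 hR1
  have hPc := oct_card hP
  have hQc := oct_card hQ
  refine inner_le _ _ 4 (by norm_num [hPc, hQc]) (by norm_num [hPc, hQc]) ?_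
  dsimp only
  by_cases hPQ : P = Q
  · subst hPQ
    have hSR : S ≠ R := by rintro rfl; exact h rfl
    have h1 := symm_pos hSR
    have h2 : P ∩ symmDiff S R = symmDiff S R :=
      inter_eq_right.2 (symmDiff_le_sup.trans (union_subset hS hR))
    have h3 := card_symmDiff_add S R
    rw [inter_self, h2]
    omega
  · have h1 := oct_inter hP hQ hPQ
    omega

theorem i23 {p q : Idx} (hp : p ∈ T2) (hq : q ∈ T3) :
    ⟪vec p, vec q⟫ ≤ (1 : ℝ) / 2 := by
  obtain ⟨P, S⟩ := p
  obtain ⟨Q, R⟩ := q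
  obtain ⟨hP, hS, hS1⟩ := mem_T2 hp
  obtain ⟨hQ, hR⟩ := mem_T3 hq
  simp only at hP hS hQ hR hS1
  subst hQ
  have hPc := oct_card hP
  refine inner_le _ _ 6 (by norm_num [hPc, card_univ, Fintype.card_fin]) (by norm_num [hPc, card_univ, Fintype.card_fin]) ?_
  simp only [inter_univ]
  have h1 := oct_sign hP hR
  have h2 : P ∩ symmDiff S R = symmDiff S (P ∩ R) := by
    ext i
    have := @hS i
    simp only [mem_inter, mem_symmDiff]
    tauto
  have h3 := card_symmDiff_add S (P ∩ R)
  rw [h2]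
  omega

theorem i33 {p q : Idx} (hp : p ∈ T3) (hq : q ∈ T3) (h : p ≠ q) :
    ⟪vec p, vec q⟫ ≤ (1 : ℝ) / 2 := by
  obtain ⟨P, S⟩ := p
  obtain ⟨Q, R⟩ := q
  obtain ⟨hP, hS⟩ := mem_T3 hp
  obtain ⟨hQ, hR⟩ := mem_T3 hq
  simp only at hP hS hQ hR
  subst hP hQ
  have hSR : S ≠ R := by rintro rfl; exact h rfl
  have h1 := sign_dist hS hR hSR
  refine inner_le _ _ 10 (by norm_num [card_univ, Fintype.card_fin, univ_inter]) (by norm_num [card_univ, Fintype.card_fin, univ_inter]) ?_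
  simp only [univ_inter, card_univ, Fintype.card_fin]
  omega

theorem inner_T {p q : Idx} (hp : p ∈ T) (hq : q ∈ T) (h : p ≠ q) :
    ⟪vec p, vec q⟫ ≤ (1 : ℝ) / 2 := by
  simp only [T, mem_union] at hp hq
  rcases hp with (hp | hp) | hp <;> rcases hq with (hq | hq) | hq
  · exact i11 hp hq h
  · exact i12 hp hq
  · exact i13 hp hq
  · rw [real_inner_comm]; exact i12 hq hp
  · exact i22 hp hq h
  · exact i23 hp hq
  · rw [real_inner_comm]; exact i13 hq hp
  · rw [real_inner_comm]; exact i23 hq hp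
  · exact i33 hp hq h

theorem inj_vec : Set.InjOn vec (T : Set Idx) := by
  intro p hp q hq hpq
  by_contra h
  have h1 := inner_T hp hq h
  rw [← hpq, real_inner_self_eq_norm_sq, norm_vec hp] at h1
  norm_num at h1

end Kiss

/-- The kissing number in 20 dimensions is at least 19448: there is a set of 19448 unit
vectors in Euclidean space ℝ^20 whose pairwise inner products are at most 1/2. -/
theorem kissing_dim20_ge_19448 :
    ∃ V : Finset (EuclideanSpace ℝ (Fin 20)),
      V.card = 19448 ∧
      (∀ v ∈ V, ‖v‖ = 1) ∧
      (∀ v ∈ V, ∀ w ∈ V, v ≠ w → ⟪v, w⟫ ≤ (1 : ℝ) / 2) := by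
  classical
  refine ⟨Kiss.T.image Kiss.vec, ?_, ?_, ?_⟩
  · rw [Finset.card_image_of_injOn Kiss.inj_vec, Kiss.card_T]
  · intro v hv
    obtain ⟨p, hp, rfl⟩ := Finset.mem_image.1 hv
    exact Kiss.norm_vec hp
  · intro v hv w hw h
    obtain ⟨p, hp, rfl⟩ := Finset.mem_image.1 hv
    obtain ⟨q, hq, rfl⟩ := Finset.mem_image.1 hw
    exact Kiss.inner_T hp hq (fun e => h (by rw [e]))
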